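/- There is a universal constant C > 0 with the following property. Let u : ℝ → ℝ be a Schwartz function satisfying ‖u‖_{Ḃ^{-1/2}_{2,∞}} + ‖Lu‖_{Ḣ^{1/2}} ≤ 1, where Lu(x) := x·u(x) - 3u''(x). Then for every R ≥ 1, ‖Lu‖_{L²(A_R)} ≤ C·R^{1/2}, where A_R := { x ∈ ℝ : R ≤ (x²+1)^{1/2} ≤ 2R }. -/

import Mathlib

open MeasureTheory Real SchwartzMap Set
open scoped FourierTransform

noncomputable section

/-- Fourier transform of a real-valued function on `ℝ`. -/
def FT (u : ℝ → ℝ) : ℝ → ℂ := 𝓕 (fun x => (u x : ℂ))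

/-- Homogeneous Sobolev norm `‖u‖_{Ḣˢ}`. -/
def HsNorm (s : ℝ) (u : ℝ → ℝ) : ℝ :=
  (∫ ξ : ℝ, |ξ| ^ (2 * s) * ‖FT u ξ‖ ^ 2) ^ (1/2 : ℝ)

/-- Homogeneous Besov norm `‖u‖_{Ḃ^{-1/2}_{2,∞}}`. -/
def BesovNorm (u : ℝ → ℝ) : ℝ :=
  ⨆ j : ℤ, (2:ℝ) ^ (-(j:ℝ)/2) *
    (∫ ξ in {ξ : ℝ | (2:ℝ)^j ≤ |ξ| ∧ |ξ| < (2:ℝ)^(j+1)}, ‖FT u ξ‖^2) ^ (1/2:ℝ)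

/-- `L²` norm. -/
def L2Norm (u : ℝ → ℝ) : ℝ := (∫ x : ℝ, u x ^ 2) ^ (1/2:ℝ)

/-- `L²` norm restricted to a set. -/
def L2NormOn (A : Set ℝ) (u : ℝ → ℝ) : ℝ := (∫ x in A, u x ^ 2) ^ (1/2:ℝ)

/-- The time-dependent japanese bracket `⟨x⟩ = (x² + t^{2/3})^{1/2}`. -/
def jb (t x : ℝ) : ℝ := (x^2 + t ^ ((2:ℝ)/3)) ^ (1/2:ℝ)

/-- The operator `Lu = xu - 3u''` (time `t = 1` normalization). -/
def Lop (u : ℝ → ℝ) : ℝ → ℝ := fun x => x * u x - 3 * iteratedDeriv 2 u x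

/-- The dyadic region `A_R = {x : R ≤ (x²+1)^{1/2} ≤ 2R}`. -/
def AR (R : ℝ) : Set ℝ :=
  {x : ℝ | R ≤ (x^2 + 1) ^ ((1:ℝ)/2) ∧ (x^2 + 1) ^ ((1:ℝ)/2) ≤ 2 * R}

/-- Complexification of a real-valued Schwartz function. -/
def complexify (u : 𝓢(ℝ, ℝ)) : 𝓢(ℝ, ℂ) := u.postcompCLM Complex.ofRealCLM

lemma complexify_apply (u : 𝓢(ℝ, ℝ)) (x : ℝ) : complexify u x = (u x : ℂ) := rfl

/-- Multiplication by the coordinate on Schwartz space. -/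
def mulCoord (f : 𝓢(ℝ, ℂ)) : 𝓢(ℝ, ℂ) := smulLeftCLM ℂ (fun x : ℝ => (x : ℂ)) f

lemma mulCoord_apply (f : 𝓢(ℝ, ℂ)) (x : ℝ) : mulCoord f x = (x : ℂ) * f x := by
  have h : Function.HasTemperateGrowth (fun x : ℝ => (x : ℂ)) :=
    Complex.ofRealCLM.hasTemperateGrowth
  simp [mulCoord, smulLeftCLM_apply_apply h]

lemma FT_eq_fourier_complexify (u : 𝓢(ℝ, ℝ)) : FT u = (𝓕 (complexify u) : 𝓢(ℝ, ℂ)) := by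
  rw [fourier_coe]; rfl

lemma fourier_mulCoord (f : 𝓢(ℝ, ℂ)) (ξ : ℝ) :
    𝓕 (mulCoord f) ξ = (-2 * π * Complex.I)⁻¹ * deriv (𝓕 f : 𝓢(ℝ, ℂ)) ξ := by
  have h1 : Integrable (fun x : ℝ => x • f x) := by
    refine (mulCoord f).integrable.congr (.of_forall fun x => ?_)
    simp [mulCoord_apply]
  have h2 := congrFun (Real.deriv_fourier f.integrable h1) ξ
  have h3 : (fun x : ℝ => (-2 * π * Complex.I * x) • f x)
      = ((-2 * π * Complex.I : ℂ) • mulCoord f : 𝓢(ℝ, ℂ)) := by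
    ext x; simp [mulCoord_apply]; ring
  have h4 : (-2 * π * Complex.I : ℂ) ≠ 0 := by simp [Real.pi_ne_zero]
  rw [fourier_coe f, h2, h3, ← fourier_coe, FourierTransform.fourier_smul, smul_apply,
    smul_eq_mul, inv_mul_cancel_left₀ h4]

lemma fourier_derivCLM (f : 𝓢(ℝ, ℂ)) (ξ : ℝ) :
    𝓕 (derivCLM ℂ ℂ f) ξ = 2 * π * Complex.I * ξ * 𝓕 f ξ := by
  have h := congrFun (Real.fourier_deriv f.integrable f.differentiable
    (derivCLM ℂ ℂ f).integrable) ξ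
  rw [fourier_coe, fourier_coe]
  exact h

/-- The operator `Lop` on complex-valued Schwartz functions. -/
def schwartzLop (f : 𝓢(ℝ, ℂ)) : 𝓢(ℝ, ℂ) :=
  mulCoord f - (3 : ℂ) • derivCLM ℂ ℂ (derivCLM ℂ ℂ f)

lemma schwartzLop_complexify_apply (u : 𝓢(ℝ, ℝ)) (x : ℝ) :
    schwartzLop (complexify u) x = (Lop u x : ℂ) := by
  have h (v : 𝓢(ℝ, ℝ)) : derivCLM ℂ ℂ (complexify v) = complexify (derivCLM ℝ ℝ v) := by
    ext y
    exact (v.hasDerivAt y).ofReal_comp.deriv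
  simp only [schwartzLop, h, sub_apply, smul_apply, mulCoord_apply, complexify_apply, Lop,
    iteratedDeriv_succ, iteratedDeriv_zero]
  push_cast
  rfl

lemma FT_Lop (u : 𝓢(ℝ, ℝ)) : FT (Lop u) = (𝓕 (schwartzLop (complexify u)) : 𝓢(ℝ, ℂ)) := by
  rw [fourier_coe, FT]
  congr 1
  ext x
  exact (schwartzLop_complexify_apply u x).symm

lemma fourier_schwartzLop (f : 𝓢(ℝ, ℂ)) (ξ : ℝ) :
    𝓕 (schwartzLop f) ξ =
      (-2 * π * Complex.I)⁻¹ * deriv (𝓕 f : 𝓢(ℝ, ℂ)) ξ + 12 * π ^ 2 * ξ ^ 2 * 𝓕 f ξ := by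
  rw [schwartzLop, sub_eq_add_neg, ← neg_smul, FourierTransform.fourier_add,
    FourierTransform.fourier_smul, add_apply, smul_apply, fourier_mulCoord, fourier_derivCLM,
    fourier_derivCLM, smul_eq_mul]
  linear_combination (-12 * π ^ 2 * ξ ^ 2 * 𝓕 f ξ : ℂ) * Complex.I_sq

lemma SchwartzMap.integrable_norm_sq (f : 𝓢(ℝ, ℂ)) : Integrable (fun x => ‖f x‖ ^ 2) :=
  (f.memLp 2).integrable_norm_pow two_ne_zero

lemma SchwartzMap.integrable_abs_mul_norm_sq (f : 𝓢(ℝ, ℂ)) :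
    Integrable (fun x => |x| * ‖f x‖ ^ 2) := by
  refine (((mulCoord f).memLp 2).norm.integrable_mul (f.memLp 2).norm).congr
    (.of_forall fun x => ?_)
  simp [mulCoord_apply]; ring

/-- The dyadic shell `2ʲ ≤ |ξ| < 2ʲ⁺¹`. -/
def dyadicShell (j : ℤ) : Set ℝ := {ξ : ℝ | (2:ℝ)^j ≤ |ξ| ∧ |ξ| < (2:ℝ)^(j+1)}

lemma measurableSet_dyadicShell (j : ℤ) : MeasurableSet (dyadicShell j) :=
  (measurableSet_le measurable_const measurable_abs).inter
    (measurableSet_lt measurable_abs measurable_const)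

lemma two_rpow_mul_rpow_half (j : ℤ) {E : ℝ} (hE : 0 ≤ E) :
    (2:ℝ) ^ (-(j:ℝ)/2) * E ^ (1/2:ℝ) = ((2:ℝ) ^ (-j) * E) ^ (1/2:ℝ) := by
  rw [Real.mul_rpow (by positivity) hE, ← Real.rpow_intCast, ← Real.rpow_mul (by norm_num)]
  congr 2
  push_cast
  ring

lemma setIntegral_dyadicShell_le (f : 𝓢(ℝ, ℂ)) :
    ∃ K : ℝ, ∀ j : ℤ, ∫ ξ in dyadicShell j, ‖f ξ‖ ^ 2 ≤ K * 2 ^ j := by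
  obtain ⟨M, -, hM⟩ := f.decay 0 0
  have hM' (x : ℝ) : ‖f x‖ ≤ M := by simpa using hM x
  have hM0 : 0 ≤ M := (norm_nonneg _).trans (hM' 0)
  refine ⟨4 * M ^ 2, fun j => ?_⟩
  have hsub : dyadicShell j ⊆ Ioo (-(2:ℝ)^(j+1)) (2^(j+1)) := fun x hx => abs_lt.1 hx.2
  calc ∫ ξ in dyadicShell j, ‖f ξ‖ ^ 2
      ≤ ∫ ξ in Ioo (-(2:ℝ)^(j+1)) (2^(j+1)), ‖f ξ‖ ^ 2 :=
        setIntegral_mono_set f.integrable_norm_sq.integrableOn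
          (.of_forall fun x => by positivity) hsub.eventuallyLE
    _ ≤ ∫ ξ in Ioo (-(2:ℝ)^(j+1)) (2^(j+1)), M ^ 2 := by
        refine setIntegral_mono f.integrable_norm_sq.integrableOn (by simp) fun x => ?_
        exact pow_le_pow_left₀ (norm_nonneg _) (hM' x) 2
    _ = 4 * M ^ 2 * 2 ^ j := by
        have : (0:ℝ) ≤ 2 ^ j := by positivity
        simp only [integral_const, MeasurableSet.univ, measureReal_restrict_apply, univ_inter,
          smul_eq_mul, zpow_add_one₀ (two_ne_zero (α := ℝ)), Real.volume_real_Ioo]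
        rw [max_eq_left (by linarith)]
        ring

lemma BesovNorm_nonneg (u : ℝ → ℝ) : 0 ≤ BesovNorm u :=
  Real.iSup_nonneg fun j => mul_nonneg (by positivity)
    (Real.rpow_nonneg (integral_nonneg fun _ => by positivity) _)

lemma HsNorm_nonneg (s : ℝ) (u : ℝ → ℝ) : 0 ≤ HsNorm s u :=
  Real.rpow_nonneg (integral_nonneg fun _ => by positivity) _

lemma setIntegral_dyadicShell_le_of_BesovNorm_le_one {u : 𝓢(ℝ, ℝ)} (hu : BesovNorm u ≤ 1)
    (j : ℤ) : ∫ ξ in dyadicShell j, ‖𝓕 (complexify u) ξ‖ ^ 2 ≤ 2 ^ j := by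
  obtain ⟨K, hK⟩ := setIntegral_dyadicShell_le (𝓕 (complexify u))
  set E : ℤ → ℝ := fun j => ∫ ξ in dyadicShell j, ‖𝓕 (complexify u) ξ‖ ^ 2 with hE
  have hE0 (j : ℤ) : 0 ≤ E j := integral_nonneg fun _ => by positivity
  have heq : BesovNorm u = ⨆ j : ℤ, ((2:ℝ) ^ (-j) * E j) ^ (1/2:ℝ) := by
    rw [BesovNorm, FT_eq_fourier_complexify]
    exact iSup_congr fun j => two_rpow_mul_rpow_half j (hE0 j)
  have hbdd : BddAbove (range fun j : ℤ => ((2:ℝ) ^ (-j) * E j) ^ (1/2:ℝ)) := by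
    refine ⟨K ^ (1/2:ℝ), ?_⟩
    rintro _ ⟨j, rfl⟩
    have := hE0 j
    refine Real.rpow_le_rpow (by positivity) ?_ (by norm_num)
    rw [zpow_neg, inv_mul_le_iff₀ (by positivity), mul_comm]
    exact hK j
  have h1 : ((2:ℝ) ^ (-j) * E j) ^ (1/2:ℝ) ≤ 1 ^ (1/2:ℝ) := by
    rw [Real.one_rpow]
    exact (le_ciSup hbdd j).trans (heq ▸ hu)
  have h0 : 0 ≤ (2:ℝ) ^ (-j) * E j := mul_nonneg (by positivity) (hE0 j)
  replace h1 := (Real.rpow_le_rpow_iff h0 zero_le_one (by norm_num)).1 h1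
  rw [zpow_neg, inv_mul_le_iff₀ (by positivity), mul_one] at h1
  exact h1

lemma integral_abs_mul_le_one_of_HsNorm_le_one {u : 𝓢(ℝ, ℝ)}
    (hu : HsNorm ((1:ℝ)/2) (Lop u) ≤ 1) :
    ∫ ξ : ℝ, |ξ| * ‖𝓕 (schwartzLop (complexify u)) ξ‖ ^ 2 ≤ 1 := by
  have h0 : 0 ≤ ∫ ξ : ℝ, |ξ| * ‖𝓕 (schwartzLop (complexify u)) ξ‖ ^ 2 :=
    integral_nonneg fun _ => by positivity
  rw [HsNorm, FT_Lop] at hu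
  simp only [mul_one_div_cancel (two_ne_zero (α := ℝ)), Real.rpow_one] at hu
  exact (Real.rpow_le_rpow_iff h0 zero_le_one (one_half_pos (α := ℝ))).1
    (hu.trans_eq (Real.one_rpow _).symm)

/-- A function with mass at most `2ʲ` on each dyadic shell has mass at most `2a` on `|ξ| < a`. -/
lemma setIntegral_abs_lt_le {f : ℝ → ℝ} (hf : Integrable f)
    (h0 : ∀ x, 0 ≤ f x) (h : ∀ j : ℤ, ∫ ξ in dyadicShell j, f ξ ≤ 2 ^ j) {a : ℝ} (ha : 0 < a) :
    ∫ ξ in {ξ : ℝ | |ξ| < a}, f ξ ≤ 2 * a := by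
  obtain ⟨J, hJ1, hJ2⟩ := exists_mem_Ico_zpow ha (one_lt_two (α := ℝ))
  have hdisj : Pairwise (Function.onFun Disjoint fun n : ℕ => dyadicShell (J - n)) := by
    intro m n hmn
    refine Set.disjoint_left.2 fun x hx hy => ?_
    have h1 := (zpow_lt_zpow_iff_right₀ (one_lt_two (α := ℝ))).1 (hx.1.trans_lt hy.2)
    have h2 := (zpow_lt_zpow_iff_right₀ (one_lt_two (α := ℝ))).1 (hy.1.trans_lt hx.2)
    omega
  have hsum := hasSum_integral_iUnion (μ := volume) (f := f)
    (fun n : ℕ => measurableSet_dyadicShell (J - n)) hdisj hf.integrableOn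
  have hgeom : HasSum (fun n : ℕ => (2:ℝ) ^ (J - n : ℤ)) (2 ^ J * 2) := by
    have heq : (fun n : ℕ => (2:ℝ) ^ (J - n : ℤ)) = fun n : ℕ => (2:ℝ) ^ J * (1 / 2) ^ n := by
      ext n
      rw [zpow_sub₀ two_ne_zero, zpow_natCast, one_div, inv_pow, div_eq_mul_inv]
    rw [heq]
    exact hasSum_geometric_two.mul_left _
  have hle := hasSum_le (fun n : ℕ => h (J - n)) hsum hgeom
  have hsub : ({ξ : ℝ | |ξ| < a} : Set ℝ) ≤ᵐ[volume] ⋃ n : ℕ, dyadicShell (J - n) := by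
    filter_upwards [Measure.ae_ne volume (0:ℝ)] with x hx hxa
    obtain ⟨k, hk1, hk2⟩ := exists_mem_Ico_zpow (abs_pos.2 hx) (one_lt_two (α := ℝ))
    have hlt : (2:ℝ) ^ k < 2 ^ (J + 1) := hk1.trans_lt (lt_trans hxa hJ2)
    have := (zpow_lt_zpow_iff_right₀ (one_lt_two (α := ℝ))).1 hlt
    refine mem_iUnion.2 ⟨(J - k).toNat, ?_⟩
    rw [Int.toNat_of_nonneg (by omega), sub_sub_cancel]
    exact ⟨hk1, hk2⟩
  calc ∫ ξ in {ξ : ℝ | |ξ| < a}, f ξ ≤ ∫ ξ in ⋃ n : ℕ, dyadicShell (J - n), f ξ :=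
        setIntegral_mono_set hf.integrableOn (.of_forall h0) hsub
    _ ≤ 2 ^ J * 2 := hle
    _ ≤ 2 * a := by linarith

lemma exists_smooth_cutoff : ∃ (φ : ℝ → ℝ) (M : ℝ), ContDiff ℝ (⊤ : ℕ∞) φ ∧ HasCompactSupport φ ∧
    (∀ x, 0 ≤ φ x) ∧ (∀ x, φ x ≤ 1) ∧ (∀ x, |x| ≤ 1 → φ x = 1) ∧ (∀ x, 2 ≤ |x| → φ x = 0) ∧
    (∀ x, 2 ≤ |x| → deriv φ x = 0) ∧ ∀ x, |deriv φ x| ≤ M := by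
  let b : ContDiffBump (0:ℝ) := ⟨1, 2, one_pos, one_lt_two⟩
  have hz (x : ℝ) (hx : 2 ≤ |x|) : b x = 0 := b.zero_of_le_dist (by simpa using hx)
  obtain ⟨M, hM⟩ := b.hasCompactSupport.deriv.exists_bound_of_continuous
    ((b.contDiff (n := 1)).continuous_deriv le_rfl)
  refine ⟨b, M, b.contDiff, b.hasCompactSupport, fun x => b.nonneg, fun x => b.le_one,
    fun x hx => b.one_of_mem_closedBall (by simpa using hx), hz, fun x hx => ?_, hM⟩
  refine IsLocalMin.deriv_eq_zero (.of_forall fun y => ?_)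
  rw [hz x hx]
  exact b.nonneg

lemma norm_sq_add_add_le (a b c : ℂ) :
    ‖a + b + c‖ ^ 2 ≤ 3 * (‖a‖ ^ 2 + ‖b‖ ^ 2 + ‖c‖ ^ 2) := by
  have h := norm_add₃_le (a := a) (b := b) (c := c)
  have := pow_le_pow_left₀ (norm_nonneg _) h 2
  nlinarith [sq_nonneg (‖a‖ - ‖b‖), sq_nonneg (‖a‖ - ‖c‖), sq_nonneg (‖b‖ - ‖c‖)]

/-- Splitting of `L f` by a frequency cutoff at scale `1 / R`: the commutator of the cutoff with
multiplication by the coordinate produces the term with `deriv φ`. -/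
lemma exists_cutoff_decomposition (f : 𝓢(ℝ, ℂ)) {φ : ℝ → ℝ} (hφ : ContDiff ℝ (⊤ : ℕ∞) φ)
    (hc : HasCompactSupport φ) (R : ℝ) :
    ∃ P Q : 𝓢(ℝ, ℂ), schwartzLop f = mulCoord P + Q ∧
      (∀ ξ : ℝ, 𝓕 P ξ = φ (R * ξ) * 𝓕 f ξ) ∧
      ∀ ξ : ℝ, 𝓕 Q ξ = (1 - φ (R * ξ)) * 𝓕 (schwartzLop f) ξ
        + 12 * π ^ 2 * ξ ^ 2 * φ (R * ξ) * 𝓕 f ξ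
        + 2⁻¹ * (π : ℂ)⁻¹ * Complex.I⁻¹ * (R * deriv φ (R * ξ)) * 𝓕 f ξ := by
  have hφc : Function.HasTemperateGrowth (fun x : ℝ => (φ x : ℂ)) :=
    ((hc.comp_left (g := Complex.ofReal) rfl).toSchwartzMap
      (Complex.ofRealCLM.contDiff.comp hφ)).hasTemperateGrowth
  have hlin : Function.HasTemperateGrowth (fun x : ℝ => R * x) :=
    (ContinuousLinearMap.mul ℝ ℝ R).hasTemperateGrowth
  have hχ : Function.HasTemperateGrowth (fun x : ℝ => (φ (R * x) : ℂ)) := hφc.comp hlin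
  set G : 𝓢(ℝ, ℂ) := smulLeftCLM ℂ (fun x : ℝ => (φ (R * x) : ℂ)) (𝓕 f) with hG
  have hGa (ξ : ℝ) : G ξ = φ (R * ξ) * 𝓕 f ξ := by
    rw [hG, smulLeftCLM_apply_apply hχ, smul_eq_mul]
  have hGd (ξ : ℝ) : deriv G ξ =
      (deriv φ (R * ξ) * R : ℝ) * 𝓕 f ξ + φ (R * ξ) * deriv (𝓕 f : 𝓢(ℝ, ℂ)) ξ := by
    have h1 : HasDerivAt (fun x : ℝ => φ (R * x)) (deriv φ (R * ξ) * R) ξ := by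
      have := (hφ.differentiable (by simp)).differentiableAt (x := R * ξ) |>.hasDerivAt
      have h2 : HasDerivAt (fun x : ℝ => R * x) R ξ := by
        simpa using (hasDerivAt_id' ξ).const_mul R
      exact this.comp ξ h2
    rw [← (h1.ofReal_comp.mul ((𝓕 f : 𝓢(ℝ, ℂ)).hasDerivAt ξ)).deriv]
    congr 1
    ext x
    exact hGa x
  refine ⟨𝓕⁻ G, schwartzLop f - mulCoord (𝓕⁻ G), by abel, fun ξ => ?_, fun ξ => ?_⟩
  · rw [FourierTransform.fourier_fourierInv_eq, hGa]
  · rw [sub_eq_add_neg, ← neg_one_smul ℂ (mulCoord _), FourierTransform.fourier_add,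
      FourierTransform.fourier_smul, add_apply, smul_apply, fourier_mulCoord,
      FourierTransform.fourier_fourierInv_eq, hGd, fourier_schwartzLop]
    simp only [mul_inv, smul_eq_mul]
    push_cast
    ring

lemma norm_sq_fourier_remainder_le {χ χ' M R ξ : ℝ} (hR : 1 ≤ R) (h0 : 0 ≤ χ) (h1 : χ ≤ 1)
    (hone : |R * ξ| ≤ 1 → χ = 1) (hzero : 2 ≤ |R * ξ| → χ = 0) (hzero' : 2 ≤ |R * ξ| → χ' = 0)
    (hM : |χ'| ≤ M) (v w : ℂ) :
    ‖(1 - χ) * v + 12 * π ^ 2 * ξ ^ 2 * χ * w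
        + 2⁻¹ * (π : ℂ)⁻¹ * Complex.I⁻¹ * (R * χ') * w‖ ^ 2 ≤
      3 * (R * (|ξ| * ‖v‖ ^ 2)
        + (2304 * π ^ 4 + M ^ 2) * R ^ 2 * {x : ℝ | |x| < 2 / R}.indicator (fun _ => ‖w‖ ^ 2) ξ) := by
  have hR0 : 0 < R := by linarith
  have habs : |R * ξ| = R * |ξ| := by rw [abs_mul, abs_of_pos hR0]
  refine (norm_sq_add_add_le _ _ _).trans ?_
  rw [add_assoc]
  refine mul_le_mul_of_nonneg_left (add_le_add ?_ ?_) (by norm_num)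
  · have hn : ‖(1 - χ : ℂ)‖ = 1 - χ := by
      rw [← Complex.ofReal_one, ← Complex.ofReal_sub, Complex.norm_of_nonneg (by linarith)]
    rw [norm_mul, mul_pow, hn, ← mul_assoc]
    refine mul_le_mul_of_nonneg_right ?_ (by positivity)
    rcases le_total |R * ξ| 1 with h | h
    · rw [hone h]
      rw [sub_self, zero_pow two_ne_zero]
      positivity
    · rw [← habs]
      nlinarith
  · by_cases hξ : |ξ| < 2 / R
    · have hlt : R * |ξ| < 2 := by rwa [lt_div_iff₀ hR0, mul_comm] at hξ
      have hξ2 : |ξ| < 2 := hξ.trans_le (div_le_self (by norm_num) hR)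
      have hξ4 : (ξ ^ 2) ^ 2 ≤ 16 := by
        have : ξ ^ 2 ≤ 4 := by nlinarith [sq_abs ξ, abs_nonneg ξ]
        nlinarith [sq_nonneg ξ]
      rw [indicator_of_mem (by exact hξ), add_mul, add_mul]
      have hR2 : 1 ≤ R ^ 2 := by nlinarith
      refine add_le_add ?_ ?_
      · simp only [norm_mul, norm_pow, Complex.norm_real, mul_pow, Real.norm_eq_abs, sq_abs]
        refine mul_le_mul_of_nonneg_right ?_ (by positivity)
        have hχ : χ ^ 2 ≤ 1 := by nlinarith
        have hnum : ‖(12 : ℂ)‖ = 12 := by simp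
        rw [hnum]
        calc 12 ^ 2 * (π ^ 2) ^ 2 * (ξ ^ 2) ^ 2 * χ ^ 2
            ≤ 12 ^ 2 * (π ^ 2) ^ 2 * 16 * 1 := by gcongr
          _ = 2304 * π ^ 4 * 1 := by ring
          _ ≤ 2304 * π ^ 4 * R ^ 2 := by gcongr
      · simp only [norm_mul, norm_inv, Complex.norm_I, Complex.norm_real, mul_pow,
          Real.norm_eq_abs, sq_abs]
        refine mul_le_mul_of_nonneg_right ?_ (by positivity)
        have hπ : π⁻¹ ^ 2 ≤ 1 := by
          refine pow_le_one₀ (by positivity) (inv_le_one_of_one_le₀ ?_)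
          linarith [Real.pi_gt_three]
        have hnum : ‖(2 : ℂ)‖⁻¹ ^ 2 ≤ 1 := by norm_num
        have hχ' : χ' ^ 2 ≤ M ^ 2 := sq_le_sq.2 (hM.trans (le_abs_self M))
        calc ‖(2 : ℂ)‖⁻¹ ^ 2 * |π|⁻¹ ^ 2 * 1⁻¹ ^ 2 * (R ^ 2 * χ' ^ 2)
            ≤ 1 * 1 * 1 * (R ^ 2 * M ^ 2) := by
              rw [abs_of_pos Real.pi_pos, inv_one, one_pow]
              gcongr
          _ = M ^ 2 * R ^ 2 := by ring
    · have hge : 2 ≤ |R * ξ| := by rwa [not_lt, div_le_iff₀ hR0, mul_comm, ← habs] at hξ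
      rw [indicator_of_notMem (by exact hξ), hzero hge, hzero' hge]
      simp

lemma measurableSet_AR (R : ℝ) : MeasurableSet (AR R) := by
  have h : Measurable fun x : ℝ => (x ^ 2 + 1) ^ ((1:ℝ) / 2) := by fun_prop
  exact (measurableSet_le measurable_const h).inter (measurableSet_le h measurable_const)

lemma sq_le_of_mem_AR {R x : ℝ} (hR : 1 ≤ R) (hx : x ∈ AR R) : x ^ 2 ≤ 4 * R ^ 2 := by
  have h := hx.2
  rw [← Real.sqrt_eq_rpow, Real.sqrt_le_left (by linarith)] at h
  nlinarith

lemma exists_setIntegral_AR_le : ∃ K : ℝ, 0 < K ∧ ∀ u : 𝓢(ℝ, ℝ), BesovNorm u ≤ 1 →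
    HsNorm ((1:ℝ)/2) (Lop u) ≤ 1 → ∀ R : ℝ, 1 ≤ R →
      ∫ x in AR R, Lop u x ^ 2 ≤ K * R := by
  obtain ⟨φ, M, hφ, hc, h0, h1, hone, hzero, hzero', hM⟩ := exists_smooth_cutoff
  refine ⟨38 + 24 * (2304 * π ^ 4 + M ^ 2), by positivity, fun u hB hH R hR => ?_⟩
  have hR0 : 0 < R := by linarith
  set A := 2304 * π ^ 4 + M ^ 2 with hA
  have hA0 : 0 ≤ A := by positivity
  set f := complexify u
  obtain ⟨P, Q, hPQ, hP, hQ⟩ := exists_cutoff_decomposition f hφ hc R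
  have hlow : ∫ ξ in {ξ : ℝ | |ξ| < 2 / R}, ‖𝓕 f ξ‖ ^ 2 ≤ 2 * (2 / R) :=
    setIntegral_abs_lt_le (𝓕 f : 𝓢(ℝ, ℂ)).integrable_norm_sq (fun _ => by positivity)
      (setIntegral_dyadicShell_le_of_BesovNorm_le_one hB) (by positivity)
  have hmeas : MeasurableSet {ξ : ℝ | |ξ| < 2 / R} :=
    measurableSet_lt measurable_abs measurable_const
  rw [← integral_indicator hmeas] at hlow
  have hiF := (𝓕 f : 𝓢(ℝ, ℂ)).integrable_norm_sq.indicator hmeas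
  have hPle : ∫ x, ‖P x‖ ^ 2 ≤ 2 * (2 / R) := by
    rw [← integral_norm_sq_fourier]
    refine (integral_mono (𝓕 P : 𝓢(ℝ, ℂ)).integrable_norm_sq hiF fun ξ => ?_).trans hlow
    dsimp only
    rw [hP]
    by_cases hξ : |ξ| < 2 / R
    · rw [indicator_of_mem (by exact hξ), norm_mul, mul_pow, Complex.norm_of_nonneg (h0 _)]
      exact mul_le_of_le_one_left (by positivity) (pow_le_one₀ (h0 _) (h1 _))
    · rw [indicator_of_notMem (by exact hξ), hzero _ ?_]
      · simp
      · rwa [not_lt, div_le_iff₀ hR0, mul_comm, ← abs_of_pos hR0, ← abs_mul] at hξ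
  have hQle : ∫ x, ‖Q x‖ ^ 2 ≤ 3 * (R + A * R ^ 2 * (2 * (2 / R))) := by
    rw [← integral_norm_sq_fourier]
    have hi1 := (𝓕 (schwartzLop f) : 𝓢(ℝ, ℂ)).integrable_abs_mul_norm_sq
    calc ∫ ξ, ‖𝓕 Q ξ‖ ^ 2
        ≤ ∫ ξ, 3 * (R * (|ξ| * ‖𝓕 (schwartzLop f) ξ‖ ^ 2) + A * R ^ 2 *
            {ξ : ℝ | |ξ| < 2 / R}.indicator (fun ξ => ‖𝓕 f ξ‖ ^ 2) ξ) := by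
          refine integral_mono (𝓕 Q : 𝓢(ℝ, ℂ)).integrable_norm_sq
            (((hi1.const_mul R).add (hiF.const_mul _)).const_mul 3) fun ξ => ?_
          dsimp only
          rw [hQ]
          exact norm_sq_fourier_remainder_le hR (h0 _) (h1 _) (hone _) (hzero _) (hzero' _) (hM _)
            _ _
      _ = 3 * (R * ∫ ξ, |ξ| * ‖𝓕 (schwartzLop f) ξ‖ ^ 2) + 3 * (A * R ^ 2 * ∫ ξ,
            {ξ : ℝ | |ξ| < 2 / R}.indicator (fun ξ => ‖𝓕 f ξ‖ ^ 2) ξ) := by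
          rw [integral_const_mul, integral_add (hi1.const_mul R) (hiF.const_mul _),
            integral_const_mul, integral_const_mul, mul_add]
      _ ≤ 3 * (R * 1) + 3 * (A * R ^ 2 * (2 * (2 / R))) := by
          gcongr
          exact integral_abs_mul_le_one_of_HsNorm_le_one hH
      _ = _ := by ring
  have hiP := P.integrable_norm_sq
  have hiQ := Q.integrable_norm_sq
  have hpt (x : ℝ) (hx : x ∈ AR R) :
      Lop u x ^ 2 ≤ 8 * R ^ 2 * ‖P x‖ ^ 2 + 2 * ‖Q x‖ ^ 2 := by
    have hL : Lop u x ^ 2 = ‖(x : ℂ) * P x + Q x‖ ^ 2 := by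
      rw [← mulCoord_apply, ← add_apply, ← hPQ, schwartzLop_complexify_apply, Complex.norm_real,
        Real.norm_eq_abs, sq_abs]
    have h2 := pow_le_pow_left₀ (norm_nonneg _) (norm_add_le ((x : ℂ) * P x) (Q x)) 2
    have h3 : ‖(x : ℂ) * P x‖ ^ 2 ≤ 4 * R ^ 2 * ‖P x‖ ^ 2 := by
      rw [norm_mul, mul_pow, Complex.norm_real, Real.norm_eq_abs, sq_abs]
      exact mul_le_mul_of_nonneg_right (sq_le_of_mem_AR hR hx) (by positivity)
    rw [hL]
    nlinarith [sq_nonneg (‖(x : ℂ) * P x‖ - ‖Q x‖)]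
  have hib := (hiP.const_mul (8 * R ^ 2)).add (hiQ.const_mul 2)
  calc ∫ x in AR R, Lop u x ^ 2
      ≤ ∫ x in AR R, (8 * R ^ 2 * ‖P x‖ ^ 2 + 2 * ‖Q x‖ ^ 2) := by
        refine integral_mono_of_nonneg (.of_forall fun x => sq_nonneg _) hib.integrableOn ?_
        exact (ae_restrict_iff' (measurableSet_AR R)).2 (.of_forall hpt)
    _ ≤ ∫ x, (8 * R ^ 2 * ‖P x‖ ^ 2 + 2 * ‖Q x‖ ^ 2) :=
        setIntegral_le_integral hib (.of_forall fun x => by dsimp only [Pi.zero_apply]; positivity)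
    _ = 8 * R ^ 2 * (∫ x, ‖P x‖ ^ 2) + 2 * ∫ x, ‖Q x‖ ^ 2 := by
        rw [integral_add (hiP.const_mul _) (hiQ.const_mul _), integral_const_mul,
          integral_const_mul]
    _ ≤ 8 * R ^ 2 * (2 * (2 / R)) + 2 * (3 * (R + A * R ^ 2 * (2 * (2 / R)))) := by gcongr
    _ = (38 + 24 * A) * R := by field_simp; ring

/-- Low frequency bound: `‖Lu‖_{L²(A_R)} ≲ R^{1/2}`. -/
theorem Lu_low_frequency_bound :
    ∃ C : ℝ, 0 < C ∧ ∀ u : 𝓢(ℝ, ℝ),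
      BesovNorm ⇑u + HsNorm ((1:ℝ)/2) (Lop ⇑u) ≤ 1 →
      ∀ R : ℝ, 1 ≤ R → L2NormOn (AR R) (Lop ⇑u) ≤ C * R ^ ((1:ℝ)/2) := by
  obtain ⟨K, hK, h⟩ := exists_setIntegral_AR_le
  refine ⟨K ^ ((1:ℝ)/2), by positivity, fun u hu R hR => ?_⟩
  have hB := BesovNorm_nonneg u
  have hH := HsNorm_nonneg ((1:ℝ)/2) (Lop u)
  rw [← Real.mul_rpow hK.le (by linarith)]
  exact Real.rpow_le_rpow (integral_nonneg fun _ => sq_nonneg _)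
    (h u (by linarith) (by linarith) R hR) (by norm_num)
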